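/- Let A₂₁ ∈ ℝ^{p×m} be entrywise nonpositive and A₂₂ ∈ ℝ^{p×p} be entrywise nonnegative, and suppose the controllability matrix R(A₂₂, A₂₁) = [A₂₁ | A₂₂A₂₁ | ... | A₂₂^{p−1}A₂₁] has no zero rows. Then the pair (A₂₂, A₂₁) is herdable, i.e., there exists u ∈ ℝ^{pm} with every entry of R(A₂₂,A₂₁)·u strictly positive. -/

import Mathlib

open Matrix

/-- The controllability matrix `[A₂₁ | A₂₂A₂₁ | ... | A₂₂^{p-1}A₂₁]` of the pair `(A₂₂, A₂₁)`,
with columns indexed by `Fin p × Fin m`. -/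
def ctrbMat {p m : ℕ} (A₂₂ : Matrix (Fin p) (Fin p) ℝ) (A₂₁ : Matrix (Fin p) (Fin m) ℝ) :
    Matrix (Fin p) (Fin p × Fin m) ℝ :=
  Matrix.of fun i q => (A₂₂ ^ (q.1 : ℕ) * A₂₁) i q.2

/-- The controllability matrix of an entrywise nonnegative matrix and an entrywise nonpositive one
is entrywise nonpositive. -/
theorem ctrbMat_nonpos {p m : ℕ} {A : Matrix (Fin p) (Fin p) ℝ} {B : Matrix (Fin p) (Fin m) ℝ}
    (hA : ∀ i j, 0 ≤ A i j) (hB : ∀ i j, B i j ≤ 0) (i : Fin p) (q : Fin p × Fin m) :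
    ctrbMat A B i q ≤ 0 := by
  have hpow : ∀ (n : ℕ) (i j : Fin p), 0 ≤ (A ^ n) i j := by
    intro n
    induction n with
    | zero =>
      intro i j
      rw [pow_zero, Matrix.one_apply]
      split_ifs <;> norm_num
    | succ n ih =>
      intro i j
      rw [pow_succ, Matrix.mul_apply]
      exact Finset.sum_nonneg fun k _ => mul_nonneg (ih i k) (hA k j)
  rw [ctrbMat, Matrix.of_apply, Matrix.mul_apply]
  exact Finset.sum_nonpos fun k _ => mul_nonpos_of_nonneg_of_nonpos (hpow _ i k) (hB k _)

theorem stmt8 {p m : ℕ}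
    (A₂₁ : Matrix (Fin p) (Fin m) ℝ) (A₂₂ : Matrix (Fin p) (Fin p) ℝ)
    -- A₂₁ entrywise nonpositive
    (h21 : ∀ i j, A₂₁ i j ≤ 0)
    -- A₂₂ entrywise nonnegative
    (h22 : ∀ i j, 0 ≤ A₂₂ i j)
    -- R(A₂₂, A₂₁) has no zero rows
    (hrows : ∀ i : Fin p, ∃ q, ctrbMat A₂₂ A₂₁ i q ≠ 0) :
    -- the pair (A₂₂, A₂₁) is herdable
    ∃ u : Fin p × Fin m → ℝ, ∀ i, 0 < (ctrbMat A₂₂ A₂₁).mulVec u i := by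
  refine ⟨fun _ => -1, fun i => ?_⟩
  obtain ⟨q, hq⟩ := hrows i
  have hR := ctrbMat_nonpos h22 h21 i
  refine Finset.sum_pos' (fun r _ => ?_) ⟨q, Finset.mem_univ q, ?_⟩
  · linarith [hR r]
  · linarith [lt_of_le_of_ne (hR q) hq]
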